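/- Let R be a CGL extension of length N over an infinite field K, with generators x₁,…,x_N. For every nonzero normal element u ∈ R, there exists a K-algebra automorphism ψ of R such that each of x₁,…,x_N is a ψ-eigenvector (i.e., ψ(xᵢ) = ψᵢ·xᵢ for some scalars ψᵢ ∈ Kˣ) and u·a = ψ(a)·u for all a ∈ R. -/

import Mathlib

section CGLDefs

/-- `tᵐ = t₁^{m₁} ⋯ t_r^{m_r}` for a torus element `t ∈ (Kˣ)ʳ` and a character
`m ∈ ℤʳ`. -/
def tpow {K : Type*} [Field K] {r : ℕ} (t : Fin r → Kˣ) (m : Fin r → ℤ) : Kˣ :=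
  ∏ i, t i ^ m i

/-- The ordered monomial `x^f = x₁^{f₁} ⋯ x_N^{f_N}`. -/
def xmon {R : Type*} [Ring R] {N : ℕ} (x : Fin N → R) (f : Fin N → ℕ) : R :=
  ((List.finRange N).map fun i => x i ^ f i).prod

/-- `u` is a normal element of `R`: `uR = Ru`. -/
def IsNormalElem {R : Type*} [Ring R] (u : R) : Prop :=
  {y : R | ∃ t : R, y = u * t} = {y : R | ∃ t : R, y = t * u}

/-- `u` is normal in the subset `S` (a subalgebra): `uS = Su`. -/
def NormalIn {R : Type*} [Ring R] (S : Set R) (u : R) : Prop :=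
  {y : R | ∃ b ∈ S, y = u * b} = {y : R | ∃ b ∈ S, y = b * u}

/-- `u ∣ a` within `S`: `a ∈ Su`. -/
def DvdIn {R : Type*} [Ring R] (S : Set R) (u a : R) : Prop :=
  ∃ b ∈ S, a = b * u

/-- `u` is a prime element of the subring corresponding to the subset `S`:
`u ∈ S` is nonzero, normal in `S`, and generates a proper completely prime
ideal of `S`. -/
def IsPrimeElemIn {R : Type*} [Ring R] (S : Set R) (u : R) : Prop :=
  u ∈ S ∧ u ≠ 0 ∧ NormalIn S u ∧ ¬ DvdIn S u 1 ∧
    ∀ a ∈ S, ∀ b ∈ S, DvdIn S u (a * b) → DvdIn S u a ∨ DvdIn S u b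

/-- The data of a CGL extension presentation of length `N` and torus rank `r`:
generators `x₁,…,x_N`, a `ℤʳ`-grading `A` of `R` (encoding the rational torus
action), the degrees `ρ j` of the generators, and the torus elements `h k`. -/
structure CGLData (K : Type*) [Field K] (R : Type*) [Ring R] [Algebra K R]
    (N r : ℕ) where
  x : Fin N → R
  A : (Fin r → ℤ) → Submodule K R
  graded : GradedAlgebra A
  ρ : Fin N → Fin r → ℤ
  h : Fin N → Fin r → Kˣ

variable {K : Type*} [Field K] {R : Type*} [Ring R] [Algebra K R] {N r : ℕ}

/-- The action of the torus element `t ∈ (Kˣ)ʳ` on `R`: `t` acts on the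
homogeneous component of degree `m` by the scalar `tᵐ`. -/
noncomputable def CGLData.act (E : CGLData K R N r) (t : Fin r → Kˣ)
    (a : R) : R :=
  letI := E.graded
  letI : ∀ (m : Fin r → ℤ) (z : ↥(E.A m)), Decidable (z ≠ 0) :=
    fun _ _ => Classical.dec _
  (DirectSum.decompose E.A a).sum fun m z => ((tpow t m : Kˣ) : K) • (z : R)

/-- The subalgebra `R_k` generated by `x_j` for `j < k` (so `R₀ = K` and
`R_N = R`). -/
def CGLData.sub (E : CGLData K R N r) (k : ℕ) : Subalgebra K R :=
  Algebra.adjoin K {y : R | ∃ j : Fin N, (j : ℕ) < k ∧ y = E.x j}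

/-- The skew derivation `δ_k(b) = x_k·b − σ_k(b)·x_k`, where
`σ_k = (h_k ·)`. -/
noncomputable def CGLData.D (E : CGLData K R N r) (k : Fin N) (a : R) : R :=
  E.x k * a - E.act (E.h k) a * E.x k

/-- The conditions making the data `E` a CGL extension presentation:
the ordered monomials in the `x_i` form a `K`-basis of `R` (PBW);
each `x_i` is a nonzero homogeneous element of degree `ρ i`;
for each `k`, `σ_k := (h_k ·)` and `δ_k` map `R_{k-1}` to itself (so that
`R_k = R_{k-1}[x_k; σ_k, δ_k]`, with `σ_k(x_j) = λ_{kj} x_j` for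
`λ_{kj} := h_k^{ρ j}` automatically);
each `δ_k` is locally nilpotent on `R_{k-1}`;
and `λ_k := h_k^{ρ k}` is not a root of unity. -/
structure CGLData.IsCGL (E : CGLData K R N r) : Prop where
  pbw : ∀ a : R, ∃! c : (Fin N → ℕ) →₀ K, a = c.sum fun f t => t • xmon E.x f
  xhom : ∀ i : Fin N, E.x i ∈ E.A (E.ρ i)
  xne : ∀ i : Fin N, E.x i ≠ 0
  sigma_stab : ∀ k : Fin N, ∀ b ∈ E.sub (k : ℕ), E.act (E.h k) b ∈ E.sub (k : ℕ)
  delta_stab : ∀ k : Fin N, ∀ b ∈ E.sub (k : ℕ), E.D k b ∈ E.sub (k : ℕ)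
  delta_nil : ∀ k : Fin N, ∀ b ∈ E.sub (k : ℕ), ∃ n : ℕ, (E.D k)^[n] b = 0
  notroot : ∀ k : Fin N, ∀ n : ℕ, 1 ≤ n → (tpow (E.h k) (E.ρ k)) ^ n ≠ 1

/-- `u` is a homogeneous prime element of the subalgebra of `R` given by the
subset `S`, for the grading of the CGL datum `E`. -/
def CGLData.IsHomogPrimeIn (E : CGLData K R N r) (S : Set R) (u : R) : Prop :=
  IsPrimeElemIn S u ∧ ∃ m : Fin r → ℤ, u ∈ E.A m

/-- `s(j) > k` for the level sets of `μ`: there is no `j'` with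
`j < j' ≤ k` and `μ(j') = μ(j)`. -/
def SGt {N n : ℕ} (μ : Fin N → Fin n) (j k : Fin N) : Prop :=
  ∀ j' : Fin N, j < j' → j' ≤ k → μ j' ≠ μ j

/-- `s(j) = +∞` for the level sets of `μ`. -/
def SInf {N n : ℕ} (μ : Fin N → Fin n) (j : Fin N) : Prop :=
  ∀ j' : Fin N, j < j' → μ j' ≠ μ j

/-- `p(k) = −∞` for the level sets of `μ`. -/
def PInf {N n : ℕ} (μ : Fin N → Fin n) (k : Fin N) : Prop :=
  ∀ j : Fin N, j < k → μ j ≠ μ k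

/-- `p(k) = j` for the level sets of `μ`. -/
def IsPred {N n : ℕ} (μ : Fin N → Fin n) (j k : Fin N) : Prop :=
  j < k ∧ μ j = μ k ∧ ∀ j' : Fin N, j < j' → j' < k → μ j' ≠ μ k

/-- The multiplicatively skewsymmetric extension of the matrix
`λ_{km} = h_k^{ρ m}` (for `m < k`). -/
def CGLData.lam (E : CGLData K R N r) (k m : Fin N) : Kˣ :=
  if m < k then tpow (E.h k) (E.ρ m)
  else if k < m then (tpow (E.h m) (E.ρ k))⁻¹
  else 1

/-- The scalars `α_{kj} = ∏_{m=0}^{O₋(j)} λ_{k,p^m(j)}`; the iterates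
`p^m(j)` run exactly over `{i ≤ j : μ(i) = μ(j)}`. -/
def CGLData.alpha (E : CGLData K R N r) {n : ℕ} (μ : Fin N → Fin n)
    (k j : Fin N) : Kˣ :=
  ∏ m ∈ Finset.univ.filter fun m : Fin N => m ≤ j ∧ μ m = μ j, E.lam k m

/-- The scalars
`q_{kj} = ∏_{i=0}^{O₋(k)} ∏_{m=0}^{O₋(j)} λ_{p^i(k),p^m(j)}`; the iterates
`p^i(k)` run exactly over `{i ≤ k : μ(i) = μ(k)}`. -/
def CGLData.q (E : CGLData K R N r) {n : ℕ} (μ : Fin N → Fin n)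
    (k j : Fin N) : Kˣ :=
  ∏ i ∈ Finset.univ.filter fun i : Fin N => i ≤ k ∧ μ i = μ k,
    ∏ m ∈ Finset.univ.filter fun m : Fin N => m ≤ j ∧ μ m = μ j, E.lam i m

end CGLDefs

section Leibniz

variable {K : Type*} [Field K] {R : Type*} [Ring R] [Algebra K R]

/-- The skew derivation `b ↦ x b - σ(b) x` as a linear map. -/
def skewInner (σ : R →ₐ[K] R) (x : R) : R →ₗ[K] R :=
  LinearMap.mulLeft K x - (LinearMap.mulRight K x) ∘ₗ σ.toLinearMap

theorem skewInner_apply (σ : R →ₐ[K] R) (x b : R) :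
    skewInner σ x b = x * b - σ b * x := rfl

theorem skewInner_mul (σ : R →ₐ[K] R) (x a b : R) :
    skewInner σ x (a * b) = skewInner σ x a * b + σ a * skewInner σ x b := by
  simp only [skewInner_apply, map_mul]
  noncomm_ring

/-- Gaussian binomial coefficients, indexed by the two lower parameters. -/
def gaussBinom (t : K) : ℕ → ℕ → K
  | 0, _ => 1
  | _ + 1, 0 => 1
  | p + 1, q + 1 => gaussBinom t p (q + 1) + t ^ (p + 1) * gaussBinom t (p + 1) q

theorem gaussBinom_mul_prod (t : K) : ∀ p q : ℕ,
    gaussBinom t p q * ((∏ i ∈ Finset.range p, (1 - t ^ (i + 1))) *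
      ∏ i ∈ Finset.range q, (1 - t ^ (i + 1))) =
      ∏ i ∈ Finset.range (p + q), (1 - t ^ (i + 1))
  | 0, q => by simp [gaussBinom]
  | p + 1, 0 => by simp [gaussBinom]
  | p + 1, q + 1 => by
    have h1 := gaussBinom_mul_prod t p (q + 1)
    have h2 := gaussBinom_mul_prod t (p + 1) q
    rw [show p + 1 + q = p + q + 1 by ring] at h2
    rw [show p + (q + 1) = p + q + 1 by ring] at h1
    rw [show p + 1 + (q + 1) = p + q + 1 + 1 by ring, Finset.prod_range_succ _ (p + q + 1)]
    rw [Finset.prod_range_succ _ q] at h1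
    rw [Finset.prod_range_succ _ p] at h2
    rw [gaussBinom, Finset.prod_range_succ _ p, Finset.prod_range_succ _ q]
    linear_combination (1 - t ^ (p + 1)) * h1 + t ^ (p + 1) * (1 - t ^ (q + 1)) * h2

theorem gaussBinom_ne_zero {t : K} (ht : ∀ n : ℕ, 1 ≤ n → t ^ n ≠ 1) (p q : ℕ) :
    gaussBinom t p q ≠ 0 := by
  intro h
  have h1 := gaussBinom_mul_prod t p q
  rw [h, zero_mul] at h1
  obtain ⟨i, -, hi⟩ := Finset.prod_eq_zero_iff.1 h1.symm
  exact ht (i + 1) (by omega) (sub_eq_zero.1 hi).symm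

theorem skewInner_sigma {σ : R →ₐ[K] R} {x : R} {l : K} (hl : l ≠ 0) (hx : σ x = l • x) (b : R) :
    skewInner σ x (σ b) = l⁻¹ • σ (skewInner σ x b) := by
  simp only [skewInner_apply, map_sub, map_mul, hx, smul_mul_assoc, mul_smul_comm, ← smul_sub]
  rw [inv_smul_smul₀ hl]

theorem skewInner_iterate_sigma {σ : R →ₐ[K] R} {x : R} {l : K} (hl : l ≠ 0) (hx : σ x = l • x)
    (n : ℕ) (b : R) :
    (skewInner σ x)^[n] (σ b) = l⁻¹ ^ n • σ ((skewInner σ x)^[n] b) := by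
  induction n with
  | zero => simp
  | succ n ih =>
    rw [Function.iterate_succ_apply', ih, map_smul, skewInner_sigma hl hx,
      Function.iterate_succ_apply', smul_smul, pow_succ]

/-- Top term of the `q`-Leibniz rule. -/
theorem skewInner_iterate_mul {σ : R →ₐ[K] R} {x : R} {l : K} (hl : l ≠ 0) (hx : σ x = l • x) :
    ∀ (p q : ℕ) (a b : R), (skewInner σ x)^[p + 1] a = 0 → (skewInner σ x)^[q + 1] b = 0 →
      (skewInner σ x)^[p + q] (a * b) =
        gaussBinom l⁻¹ p q • (σ^[q] ((skewInner σ x)^[p] a) * (skewInner σ x)^[q] b)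
  | 0, 0, a, b, _, _ => by simp [gaussBinom]
  | 0, q + 1, a, b, ha, hb => by
    have ha' : skewInner σ x a = 0 := by simpa using ha
    have hσ : (skewInner σ x)^[0 + 1] (σ a) = 0 := by
      rw [skewInner_iterate_sigma hl hx, ha, map_zero, smul_zero]
    have h := skewInner_iterate_mul hl hx 0 q (σ a) (skewInner σ x b) hσ hb
    rw [← add_assoc, Function.iterate_succ_apply, skewInner_mul, ha', zero_mul,
      zero_add (σ a * _), h]
    cases q <;> simp [gaussBinom]
  | p + 1, 0, a, b, ha, hb => by
    have hb' : skewInner σ x b = 0 := by simpa using hb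
    have h := skewInner_iterate_mul hl hx p 0 (skewInner σ x a) b ha hb
    rw [add_zero p] at h
    rw [add_right_comm p 1 0, Function.iterate_succ_apply, skewInner_mul, hb', mul_zero,
      add_zero (_ * b), h]
    cases p <;> simp [gaussBinom]
  | p + 1, q + 1, a, b, ha, hb => by
    have hσ : (skewInner σ x)^[p + 1 + 1] (σ a) = 0 := by
      rw [skewInner_iterate_sigma hl hx, ha, map_zero, smul_zero]
    have h1 := skewInner_iterate_mul hl hx p (q + 1) (skewInner σ x a) b ha hb
    have h2 := skewInner_iterate_mul hl hx (p + 1) q (σ a) (skewInner σ x b) hσ hb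
    have e : p + 1 + q = p + (q + 1) := by ring
    have hs : ∀ (c : K) (z : R), σ^[q] (c • z) = c • σ^[q] z := fun c z => by
      rw [← AlgHom.coe_pow, map_smul]
    rw [show p + 1 + (q + 1) = p + (q + 1) + 1 by ring, Function.iterate_succ_apply,
      skewInner_mul, iterate_map_add, h1, ← e, h2, skewInner_iterate_sigma hl hx, hs,
      gaussBinom, add_smul, smul_mul_assoc, smul_smul]
    simp only [Function.iterate_succ_apply]
    rw [mul_comm]

/-- A twisted inner perturbation of a `q`-skew derivation by a nonzero `σ`-eigenvector is not
nilpotent on that eigenvector. -/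
theorem perturbed_iterate_ne_zero {S : Subalgebra K R}
    (hdom : ∀ a ∈ S, ∀ b ∈ S, a * b = 0 → a = 0 ∨ b = 0)
    {σ : R →ₐ[K] R} (hinj : Function.Injective σ) {x : R} {l : K} (hl : l ≠ 0)
    (hroot : ∀ n : ℕ, 1 ≤ n → l ^ n ≠ 1) (hx : σ x = l • x)
    (hσS : ∀ b ∈ S, σ b ∈ S) (hDS : ∀ b ∈ S, skewInner σ x b ∈ S)
    {d : R} (hdS : d ∈ S) (hd : d ≠ 0) (hσd : σ d = l • d)
    (hnil : ∃ n : ℕ, (skewInner σ x)^[n] d = 0) (g : K) (j : ℕ) :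
    (skewInner σ (g • x + d))^[j] d ≠ 0 := by
  classical
  have hroot' : ∀ n : ℕ, 1 ≤ n → l⁻¹ ^ n ≠ 1 := fun n hn h => hroot n hn (by
    rwa [inv_pow, inv_eq_one] at h)
  set D := skewInner σ x with hD
  have hDit : ∀ (n : ℕ), ∀ b ∈ S, D^[n] b ∈ S := fun n => by
    induction n with
    | zero => exact fun b hb => hb
    | succ n ih => exact fun b hb => ih _ (hDS b hb)
  have hσit : ∀ (n : ℕ), ∀ b ∈ S, σ^[n] b ∈ S := fun n => by
    induction n with
    | zero => exact fun b hb => hb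
    | succ n ih => exact fun b hb => ih _ (hσS b hb)
  have hmono : ∀ {p q : ℕ} {b : R}, D^[p] b = 0 → p ≤ q → D^[q] b = 0 := by
    intro p q b h hpq
    obtain ⟨c, rfl⟩ := Nat.exists_eq_add_of_le hpq
    rw [add_comm, Function.iterate_add_apply, h, iterate_map_zero]
  obtain ⟨m, hm, hm1⟩ : ∃ m, D^[m] d ≠ 0 ∧ D^[m + 1] d = 0 := by
    have h0 : Nat.find hnil ≠ 0 := by
      intro h
      have := Nat.find_spec hnil
      rw [h] at this
      exact hd this
    obtain ⟨m, hm⟩ := Nat.exists_eq_succ_of_ne_zero h0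
    refine ⟨m, Nat.find_min hnil (by omega), ?_⟩
    have := Nat.find_spec hnil
    rwa [hm] at this
  have hpow : ∀ j : ℕ, D^[m * (j + 1)] (d ^ (j + 1)) ≠ 0 ∧
      D^[m * (j + 1) + 1] (d ^ (j + 1)) = 0 := by
    intro j
    induction j with
    | zero => simpa using ⟨hm, hm1⟩
    | succ j ih =>
      have h1 := skewInner_iterate_mul hl hx m (m * (j + 1)) d (d ^ (j + 1)) hm1 ih.2
      have h2 := skewInner_iterate_mul hl hx m (m * (j + 1) + 1) d (d ^ (j + 1)) hm1
        (hmono ih.2 (Nat.le_succ _))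
      rw [← hD, ← pow_succ', show m + m * (j + 1) = m * (j + 1 + 1) by ring] at h1
      rw [← hD, ← pow_succ', show m + (m * (j + 1) + 1) = m * (j + 1 + 1) + 1 by ring,
        ih.2, mul_zero, smul_zero] at h2
      refine ⟨?_, h2⟩
      rw [h1]
      refine smul_ne_zero (gaussBinom_ne_zero hroot' _ _) fun h => ?_
      rcases hdom _ (hσit _ _ (hDit _ _ hdS)) _ (hDit _ _ (pow_mem hdS _)) h with h | h
      · exact hm ((hinj.iterate _) (h.trans (iterate_map_zero σ _).symm))
      · exact ih.1 h
  have key : ∀ j : ℕ, ∃ c : K, ∃ e : R, c ≠ 0 ∧ D^[m * (j + 1)] e = 0 ∧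
      (skewInner σ (g • x + d))^[j] d = c • d ^ (j + 1) + e := by
    intro j
    induction j with
    | zero => exact ⟨1, 0, one_ne_zero, iterate_map_zero _ _, by simp⟩
    | succ j ih =>
      obtain ⟨c, e, hc, he, heq⟩ := ih
      have happ : ∀ b, skewInner σ (g • x + d) b = g • D b + (d * b - σ b * d) := fun b => by
        simp only [hD, skewInner_apply, add_mul, mul_add, smul_mul_assoc, mul_smul_comm, smul_sub]
        abel
      refine ⟨c * (1 - l ^ (j + 1)),
        c • g • D (d ^ (j + 1)) + (g • D e + (d * e - σ e * d)), ?_, ?_, ?_⟩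
      · exact mul_ne_zero hc (sub_ne_zero.2 (hroot _ (by omega)).symm)
      · have e1 : D^[m * (j + 1 + 1)] (D (d ^ (j + 1))) = 0 := by
          rw [← Function.iterate_succ_apply]
          exact hmono (hpow j).2 (by nlinarith)
        have e2 : D^[m * (j + 1 + 1)] (D e) = 0 := by
          rw [← Function.iterate_succ_apply]
          exact hmono he (by nlinarith)
        have he' : D^[m * (j + 1) + 1] e = 0 := hmono he (Nat.le_succ _)
        have e3 : D^[m * (j + 1 + 1)] (d * e) = 0 := by
          have := skewInner_iterate_mul hl hx m (m * (j + 1)) d e hm1 he'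
          rw [show m * (j + 1 + 1) = m + m * (j + 1) by ring, hD, this, ← hD, he, mul_zero,
            smul_zero]
        have e4 : D^[m * (j + 1 + 1)] (σ e * d) = 0 := by
          have hs : ∀ n, D^[n] e = 0 → D^[n] (σ e) = 0 := fun n hn => by
            rw [hD, skewInner_iterate_sigma hl hx, ← hD, hn, map_zero, smul_zero]
          have := skewInner_iterate_mul hl hx (m * (j + 1)) m (σ e) d (hs _ he') hm1
          rw [show m * (j + 1 + 1) = m * (j + 1) + m by ring, hD, this, ← hD, hs _ he,
            iterate_map_zero, zero_mul, smul_zero]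
        rw [← Module.End.coe_pow] at e1 e2 e3 e4 ⊢
        simp only [map_add, map_sub, map_smul, e1, e2, e3, e4, smul_zero, add_zero, sub_zero]
      · rw [Function.iterate_succ_apply', heq, map_add, map_smul, happ, happ, map_pow σ, hσd,
          smul_pow, smul_mul_assoc, ← pow_succ, ← pow_succ']
        module
  obtain ⟨c, e, hc, he, heq⟩ := key j
  intro h
  have h1 : D^[m * (j + 1)] (c • d ^ (j + 1) + e) = 0 := by
    rw [← heq, h, iterate_map_zero]
  rw [iterate_map_add, he, add_zero, ← Module.End.coe_pow, map_smul, Module.End.coe_pow] at h1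
  exact smul_ne_zero hc (hpow j).1 h1

end Leibniz

section Graded

/-- In a domain graded by an ordered group (through `f`), if `u x = y u` with `x` homogeneous of
degree `ρ`, then every degree in the support of `y` is at most `ρ`. -/
theorem degree_le_of_mul_eq {K R ι L : Type*} [Field K] [Ring R] [Algebra K R] [AddCommGroup ι]
    [DecidableEq ι] [AddCommGroup L] [LinearOrder L] [IsOrderedAddMonoid L]
    (A : ι → Submodule K R) [GradedAlgebra A] [NoZeroDivisors R] (f : ι →+ L)
    (hf : Function.Injective f) {u x y : R} {ρ : ι} (hu : u ≠ 0) (hx : x ∈ A ρ)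
    (h : u * x = y * u) (m : ι) (hm : (DirectSum.decompose A y m : R) ≠ 0) : f m ≤ f ρ := by
  classical
  have hsupp : ∀ (z : R) (i : ι), i ∈ (DirectSum.decompose A z).support ↔
      (DirectSum.decompose A z i : R) ≠ 0 := fun z i => by simp
  have hne : (DirectSum.decompose A u).support.Nonempty := by
    rw [Finset.nonempty_iff_ne_empty]
    intro h0
    apply hu
    have h1 := DirectSum.sum_support_decompose A u
    rwa [h0, Finset.sum_empty, eq_comm] at h1
  obtain ⟨M, hM, hMmax⟩ := Finset.exists_max_image _ f hne
  obtain ⟨Y, hY, hYmax⟩ := Finset.exists_max_image (DirectSum.decompose A y).support f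
    ⟨m, (hsupp y m).2 hm⟩
  refine (hYmax m ((hsupp y m).2 hm)).trans ?_
  have htop : (DirectSum.decompose A (y * u) (Y + M) : R) =
      DirectSum.decompose A y Y * DirectSum.decompose A u M := by
    rw [DirectSum.decompose_mul, DirectSum.coe_mul_apply, Finset.sum_eq_single (Y, M)]
    · rintro ⟨i, j⟩ hij hne
      rw [Finset.mem_filter, Finset.mem_product] at hij
      obtain ⟨⟨hi, hj⟩, hs⟩ := hij
      have hi' := hYmax i hi
      have hj' := hMmax j hj
      have hs' : f i + f j = f Y + f M := by rw [← map_add, ← map_add]; exact congrArg f hs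
      have h1 : f i = f Y := by
        by_contra hlt
        exact absurd hs' (add_lt_add_of_lt_of_le (lt_of_le_of_ne hi' hlt) hj').ne
      have h2 : f j = f M := by rw [h1] at hs'; exact add_left_cancel hs'
      exact absurd (Prod.ext (hf h1) (hf h2)) hne
    · intro hn
      exact (hn (Finset.mem_filter.2 ⟨Finset.mk_mem_product hY hM, rfl⟩)).elim
  have htop_ne : (DirectSum.decompose A (y * u) (Y + M) : R) ≠ 0 := by
    rw [htop]
    exact mul_ne_zero ((hsupp y Y).1 hY) ((hsupp u M).1 hM)
  rw [← h, show Y + M = (Y + M - ρ) + ρ by abel,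
    DirectSum.coe_decompose_mul_add_of_right_mem A hx] at htop_ne
  have h3 := hMmax (Y + M - ρ) ((hsupp u _).2 (left_ne_zero_of_mul htop_ne))
  rw [map_sub, map_add] at h3
  have h4 : f M + f Y ≤ f M + f ρ := by
    rw [add_comm (f M) (f Y)]; exact sub_le_iff_le_add.1 h3
  exact le_of_add_le_add_left h4

/-- In a `ℤʳ`-graded domain, if `u x = y u` with `u ≠ 0` and `x` homogeneous, then `y` is
homogeneous of the same degree. -/
theorem mem_of_mul_eq {K R : Type*} [Field K] [Ring R] [Algebra K R] {r : ℕ}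
    (A : (Fin r → ℤ) → Submodule K R) [GradedAlgebra A] [NoZeroDivisors R] {u x y : R}
    {ρ : Fin r → ℤ} (hu : u ≠ 0) (hx : x ∈ A ρ) (h : u * x = y * u) : y ∈ A ρ := by
  classical
  let f : (Fin r → ℤ) →+ Lex (Fin r → ℤ) := ⟨⟨toLex, rfl⟩, fun _ _ => rfl⟩
  have hf : Function.Injective f := toLex.injective
  have hnf : Function.Injective (-f) := fun a b hab => hf (neg_injective hab)
  rw [← DirectSum.sum_support_decompose A y]
  refine Submodule.sum_mem _ fun m hm => ?_
  have hm' : (DirectSum.decompose A y m : R) ≠ 0 := by simpa using hm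
  have h1 := degree_le_of_mul_eq A f hf hu hx h m hm'
  have h2 := degree_le_of_mul_eq A (-f) hnf hu hx h m hm'
  have h3 : f m = f ρ := le_antisymm h1 (neg_le_neg_iff.1 h2)
  rw [← hf h3]
  exact SetLike.coe_mem _

variable {K : Type*} [Field K] {R : Type*} [Ring R] [Algebra K R] {N r : ℕ}

theorem tpow_add (t : Fin r → Kˣ) (m n : Fin r → ℤ) : tpow t (m + n) = tpow t m * tpow t n := by
  simp [tpow, zpow_add, Finset.prod_mul_distrib]

theorem tpow_zero (t : Fin r → Kˣ) : tpow t 0 = 1 := by simp [tpow]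

theorem CGLData.act_of_mem (E : CGLData K R N r) (t : Fin r → Kˣ) {m : Fin r → ℤ} {a : R}
    (ha : a ∈ E.A m) : E.act t a = ((tpow t m : Kˣ) : K) • a := by
  let := E.graded
  let : ∀ (m : Fin r → ℤ) (z : ↥(E.A m)), Decidable (z ≠ 0) := fun _ _ => Classical.dec _
  lift a to E.A m using ha
  rw [CGLData.act, DirectSum.decompose_coe]
  exact DFinsupp.sum_single_index (by simp)

theorem CGLData.act_add (E : CGLData K R N r) (t : Fin r → Kˣ) (a b : R) :
    E.act t (a + b) = E.act t a + E.act t b := by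
  let := E.graded
  let : ∀ (m : Fin r → ℤ) (z : ↥(E.A m)), Decidable (z ≠ 0) := fun _ _ => Classical.dec _
  rw [CGLData.act, CGLData.act, CGLData.act, DirectSum.decompose_add]
  exact DFinsupp.sum_add_index (by simp) (by simp)

theorem CGLData.act_mul (E : CGLData K R N r) (t : Fin r → Kˣ) (a b : R) :
    E.act t (a * b) = E.act t a * E.act t b := by
  classical
  let := E.graded
  have h0 : E.act t 0 = 0 := by
    rw [E.act_of_mem t (Submodule.zero_mem (E.A 0)), smul_zero]
  induction a using DirectSum.Decomposition.inductionOn E.A with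
  | zero => rw [zero_mul, h0, zero_mul]
  | add a a' ha ha' => rw [add_mul, E.act_add, E.act_add, ha, ha', add_mul]
  | homogeneous a =>
    induction b using DirectSum.Decomposition.inductionOn E.A with
    | zero => rw [mul_zero, h0, mul_zero]
    | add b b' hb hb' => rw [mul_add, E.act_add, E.act_add, hb, hb', mul_add]
    | homogeneous b =>
      rw [E.act_of_mem t (SetLike.mul_mem_graded a.2 b.2), E.act_of_mem t a.2,
        E.act_of_mem t b.2, tpow_add, smul_mul_smul_comm, Units.val_mul]

/-- The action of a torus element as an algebra endomorphism. -/
noncomputable def CGLData.actHom (E : CGLData K R N r) (t : Fin r → Kˣ) : R →ₐ[K] R :=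
  letI := E.graded
  have hK : ∀ c : K, E.act t (algebraMap K R c) = algebraMap K R c := fun c => by
    rw [E.act_of_mem t (SetLike.algebraMap_mem_graded E.A c), tpow_zero, Units.val_one, one_smul]
  { toFun := E.act t
    map_one' := by simpa using hK 1
    map_mul' := E.act_mul t
    map_zero' := by simpa using hK 0
    map_add' := E.act_add t
    commutes' := hK }

theorem CGLData.actHom_apply (E : CGLData K R N r) (t : Fin r → Kˣ) (a : R) :
    E.actHom t a = E.act t a := rfl

theorem tpow_inv (t : Fin r → Kˣ) (m : Fin r → ℤ) : tpow t⁻¹ m = (tpow t m)⁻¹ := by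
  simp [tpow]

theorem CGLData.actHom_injective (E : CGLData K R N r) (t : Fin r → Kˣ) :
    Function.Injective (E.actHom t) := by
  let := E.graded
  refine Function.LeftInverse.injective (g := E.actHom t⁻¹) fun a => ?_
  induction a using DirectSum.Decomposition.inductionOn E.A with
  | zero => rw [map_zero, map_zero]
  | add a a' ha ha' => rw [map_add, map_add, ha, ha']
  | homogeneous a =>
    rw [E.actHom_apply t, E.act_of_mem t a.2, map_smul, E.actHom_apply, E.act_of_mem _ a.2,
      smul_smul, tpow_inv, Units.mul_inv, one_smul]

end Graded

section Ore

variable {K : Type*} [Field K] {R : Type*} [Ring R] [Algebra K R]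

/-- The span of the elements `a xⁱ` with `a ∈ S` and `i < n`. -/
def lowDeg (S : Subalgebra K R) (x : R) (n : ℕ) : Submodule K R :=
  Submodule.span K {y | ∃ i < n, ∃ a ∈ S, y = a * x ^ i}

/-- `r = a xⁿ + (terms of lower degree in x)` with `0 ≠ a ∈ S`. -/
def HasLead (S : Subalgebra K R) (x r : R) (n : ℕ) (a : R) : Prop :=
  a ∈ S ∧ a ≠ 0 ∧ r - a * x ^ n ∈ lowDeg S x n

variable {S : Subalgebra K R} {x : R}

theorem mul_pow_mem_lowDeg {a : R} (ha : a ∈ S) {i n : ℕ} (h : i < n) :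
    a * x ^ i ∈ lowDeg S x n :=
  Submodule.subset_span ⟨i, h, a, ha, rfl⟩

theorem lowDeg_mono {m n : ℕ} (h : m ≤ n) : lowDeg S x m ≤ lowDeg S x n :=
  Submodule.span_mono fun _ ⟨i, hi, a, ha, e⟩ => ⟨i, hi.trans_le h, a, ha, e⟩

theorem lowDeg_zero : lowDeg S x 0 = ⊥ := by
  rw [lowDeg, Submodule.span_eq_bot]
  rintro y ⟨i, hi, -⟩
  exact absurd hi (Nat.not_lt_zero i)

theorem exists_sub_mem_lowDeg {n : ℕ} {r : R} (hr : r ∈ lowDeg S x (n + 1)) :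
    ∃ a ∈ S, r - a * x ^ n ∈ lowDeg S x n := by
  induction hr using Submodule.span_induction with
  | mem y hy =>
    obtain ⟨i, hi, a, ha, rfl⟩ := hy
    rcases Nat.lt_succ_iff_lt_or_eq.1 hi with h | rfl
    · exact ⟨0, S.zero_mem, by simpa using mul_pow_mem_lowDeg ha h⟩
    · exact ⟨a, ha, by simp⟩
  | zero => exact ⟨0, S.zero_mem, by simp⟩
  | add y z _ _ hy hz =>
    obtain ⟨a, ha, hya⟩ := hy
    obtain ⟨b, hb, hzb⟩ := hz
    refine ⟨a + b, S.add_mem ha hb, ?_⟩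
    rw [add_mul, add_sub_add_comm]
    exact add_mem hya hzb
  | smul c y _ hy =>
    obtain ⟨a, ha, hya⟩ := hy
    refine ⟨c • a, S.smul_mem ha c, ?_⟩
    rw [smul_mul_assoc, ← smul_sub]
    exact Submodule.smul_mem _ c hya

theorem mem_of_mem_lowDeg_one {r : R} (hr : r ∈ lowDeg S x 1) : r ∈ S := by
  obtain ⟨a, ha, h⟩ := exists_sub_mem_lowDeg hr
  rw [lowDeg_zero, Submodule.mem_bot, pow_zero, mul_one, sub_eq_zero] at h
  exact h ▸ ha

theorem exists_hasLead {n : ℕ} {r : R} (hr : r ∈ lowDeg S x n) (h0 : r ≠ 0) :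
    ∃ m a, HasLead S x r m a := by
  induction n with
  | zero =>
    rw [lowDeg_zero, Submodule.mem_bot] at hr
    exact absurd hr h0
  | succ n ih =>
    obtain ⟨a, ha, h⟩ := exists_sub_mem_lowDeg hr
    by_cases ha0 : a = 0
    · rw [ha0, zero_mul, sub_zero] at h
      exact ih h
    · exact ⟨n, a, ha, ha0, h⟩

theorem HasLead.mem_lowDeg {r a : R} {n : ℕ} (h : HasLead S x r n a) :
    r ∈ lowDeg S x (n + 1) := by
  rw [← sub_add_cancel r (a * x ^ n)]
  exact add_mem (lowDeg_mono (Nat.le_succ n) h.2.2) (mul_pow_mem_lowDeg h.1 (Nat.lt_succ_self n))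

theorem HasLead.eq_of_zero {r a : R} (h : HasLead S x r 0 a) : r = a := by
  have h1 := h.2.2
  rwa [lowDeg_zero, Submodule.mem_bot, pow_zero, mul_one, sub_eq_zero] at h1

theorem hasLead_of_mem {b : R} (hb : b ∈ S) (h0 : b ≠ 0) : HasLead S x b 0 b :=
  ⟨hb, h0, by simp⟩

theorem hasLead_unique (hfree : ∀ n : ℕ, ∀ a ∈ S, a * x ^ n ∈ lowDeg S x n → a = 0)
    {r a b : R} {n m : ℕ} (ha : HasLead S x r n a) (hb : HasLead S x r m b) :
    n = m ∧ a = b := by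
  have aux : ∀ {n m : ℕ} {a b : R}, HasLead S x r n a → HasLead S x r m b → ¬ n < m := by
    intro n m a b ha hb hlt
    refine hb.2.1 (hfree m b hb.1 ?_)
    rw [← sub_sub_self r (b * x ^ m)]
    exact sub_mem (lowDeg_mono hlt ha.mem_lowDeg) hb.2.2
  obtain rfl : n = m := le_antisymm (not_lt.1 (aux hb ha)) (not_lt.1 (aux ha hb))
  refine ⟨rfl, sub_eq_zero.1 (hfree n _ (S.sub_mem ha.1 hb.1) ?_)⟩
  have := sub_mem hb.2.2 ha.2.2
  rwa [sub_sub_sub_cancel_left, ← sub_mul] at this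

theorem mul_mem_lowDeg_left {a r : R} {n : ℕ} (ha : a ∈ S) (hr : r ∈ lowDeg S x n) :
    a * r ∈ lowDeg S x n := by
  induction hr using Submodule.span_induction with
  | mem y hy =>
    obtain ⟨i, hi, b, hb, rfl⟩ := hy
    rw [← mul_assoc]
    exact mul_pow_mem_lowDeg (S.mul_mem ha hb) hi
  | zero => simp
  | add y z _ _ hy hz => rw [mul_add]; exact add_mem hy hz
  | smul c y _ hy => rw [mul_smul_comm]; exact Submodule.smul_mem _ c hy

theorem mul_pow_mem_lowDeg_right {r : R} {n : ℕ} (hr : r ∈ lowDeg S x n) (j : ℕ) :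
    r * x ^ j ∈ lowDeg S x (n + j) := by
  induction hr using Submodule.span_induction with
  | mem y hy =>
    obtain ⟨i, hi, b, hb, rfl⟩ := hy
    rw [mul_assoc, ← pow_add]
    exact mul_pow_mem_lowDeg hb (by omega)
  | zero => simp
  | add y z _ _ hy hz => rw [add_mul]; exact add_mem hy hz
  | smul c y _ hy => rw [smul_mul_assoc]; exact Submodule.smul_mem _ c hy

variable {σ : R →ₐ[K] R}

theorem iterate_mem (hσS : ∀ b ∈ S, σ b ∈ S) (n : ℕ) : ∀ b ∈ S, σ^[n] b ∈ S := by
  induction n with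
  | zero => exact fun b hb => hb
  | succ n ih => exact fun b hb => ih _ (hσS b hb)

theorem pow_mul_sub_mem_lowDeg (hσS : ∀ b ∈ S, σ b ∈ S) (hDS : ∀ b ∈ S, skewInner σ x b ∈ S)
    (n : ℕ) : ∀ b ∈ S, x ^ n * b - σ^[n] b * x ^ n ∈ lowDeg S x n := by
  induction n with
  | zero => intro b _; simp
  | succ n ih =>
    intro b hb
    have h1 := mul_pow_mem_lowDeg_right (ih _ (hσS b hb)) 1
    have h2 := lowDeg_mono (Nat.le_succ n) (ih _ (hDS b hb))
    have h3 := mul_pow_mem_lowDeg (x := x) (iterate_mem hσS n _ (hDS b hb)) (Nat.lt_succ_self n)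
    convert add_mem (add_mem h1 h2) h3 using 1
    rw [pow_one, sub_mul, mul_assoc, mul_assoc, ← pow_succ, Function.iterate_succ_apply,
      add_assoc, sub_add_cancel, pow_succ]
    rw [skewInner_apply, mul_sub, ← pow_succ, ← mul_assoc, ← mul_assoc, ← pow_succ]
    abel

theorem mul_mem_lowDeg (hσS : ∀ b ∈ S, σ b ∈ S) (hDS : ∀ b ∈ S, skewInner σ x b ∈ S)
    {r s : R} {n m p : ℕ} (hr : r ∈ lowDeg S x n) (hs : s ∈ lowDeg S x m) (hp : n + m ≤ p + 1) :
    r * s ∈ lowDeg S x p := by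
  induction hr using Submodule.span_induction with
  | mem y hy =>
    obtain ⟨i, hi, a, ha, rfl⟩ := hy
    induction hs using Submodule.span_induction with
    | mem z hz =>
      obtain ⟨j, hj, b, hb, rfl⟩ := hz
      have h1 := mul_pow_mem_lowDeg_right (mul_mem_lowDeg_left ha
        (pow_mul_sub_mem_lowDeg hσS hDS i b hb)) j
      have h2 := mul_pow_mem_lowDeg (x := x) (S.mul_mem ha (iterate_mem hσS i b hb))
        (Nat.lt_succ_self (i + j))
      have h3 := add_mem (lowDeg_mono (Nat.le_succ _) h1) h2
      convert lowDeg_mono (show i + j + 1 ≤ p by omega) h3 using 1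
      simp only [pow_add]
      noncomm_ring
    | zero => simp
    | add y z _ _ hy hz => rw [mul_add]; exact add_mem hy hz
    | smul c y _ hy => rw [mul_smul_comm]; exact Submodule.smul_mem _ c hy
  | zero => simp
  | add y z _ _ hy hz => rw [add_mul]; exact add_mem hy hz
  | smul c y _ hy => rw [smul_mul_assoc]; exact Submodule.smul_mem _ c hy

theorem HasLead.mul (hσS : ∀ b ∈ S, σ b ∈ S) (hDS : ∀ b ∈ S, skewInner σ x b ∈ S)
    (hinj : Function.Injective σ) (hdom : ∀ a ∈ S, ∀ b ∈ S, a * b = 0 → a = 0 ∨ b = 0)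
    {r s a b : R} {n m : ℕ} (hr : HasLead S x r n a) (hs : HasLead S x s m b) :
    HasLead S x (r * s) (n + m) (a * σ^[n] b) := by
  have hσb := iterate_mem hσS n b hs.1
  refine ⟨S.mul_mem hr.1 hσb, fun h => ?_, ?_⟩
  · rcases hdom _ hr.1 _ hσb h with h | h
    · exact hr.2.1 h
    · exact hs.2.1 ((hinj.iterate n) (h.trans (iterate_map_zero σ n).symm))
  · have h1 := mul_mem_lowDeg hσS hDS (p := n + m) hr.2.2 hs.mem_lowDeg (by omega)
    have h2 := mul_mem_lowDeg hσS hDS (p := n + m)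
      (mul_pow_mem_lowDeg hr.1 (Nat.lt_succ_self n)) hs.2.2 (by omega)
    have h3 := mul_pow_mem_lowDeg_right (mul_mem_lowDeg_left hr.1
        (pow_mul_sub_mem_lowDeg hσS hDS n b hs.1)) m
    convert add_mem (add_mem h1 h2) h3 using 1
    simp only [pow_add]
    noncomm_ring

/-- Every element of the algebra generated by `S` and `x` is a left polynomial in `x` over `S`. -/
theorem exists_mem_lowDeg (hσS : ∀ b ∈ S, σ b ∈ S) (hDS : ∀ b ∈ S, skewInner σ x b ∈ S)
    {X : Set R} (hX : ∀ z ∈ X, z ∈ S ∨ z = x) {r : R} (hr : r ∈ Algebra.adjoin K X) :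
    ∃ n, r ∈ lowDeg S x n := by
  have hS : ∀ z ∈ S, ∃ n, z ∈ lowDeg S x n := fun z hz =>
    ⟨1, by simpa using mul_pow_mem_lowDeg (x := x) hz Nat.zero_lt_one⟩
  induction hr using Algebra.adjoin_induction with
  | mem z hz =>
    rcases hX z hz with h | rfl
    · exact hS z h
    · exact ⟨2, by simpa using mul_pow_mem_lowDeg (x := z) S.one_mem Nat.one_lt_two⟩
  | algebraMap c => exact hS _ (S.algebraMap_mem c)
  | add y z _ _ hy hz =>
    obtain ⟨n, hn⟩ := hy
    obtain ⟨m, hm⟩ := hz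
    exact ⟨max n m, add_mem (lowDeg_mono (le_max_left _ _) hn) (lowDeg_mono (le_max_right _ _) hm)⟩
  | mul y z _ _ hy hz =>
    obtain ⟨n, hn⟩ := hy
    obtain ⟨m, hm⟩ := hz
    exact ⟨n + m, mul_mem_lowDeg hσS hDS hn hm (Nat.le_succ _)⟩

end Ore

section NormalElements

variable {K : Type*} [Field K] {R : Type*} [Ring R] [Algebra K R]

theorem NormalIn.exists_left {S : Set R} {u b : R} (h : NormalIn S u) (hb : b ∈ S) :
    ∃ b' ∈ S, u * b = b' * u :=
  (h.subset ⟨b, hb, rfl⟩ : u * b ∈ {y : R | ∃ b ∈ S, y = b * u})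

theorem NormalIn.exists_right {S : Set R} {u b : R} (h : NormalIn S u) (hb : b ∈ S) :
    ∃ b' ∈ S, b * u = u * b' :=
  (h.superset ⟨b, hb, rfl⟩ : b * u ∈ {y : R | ∃ b ∈ S, y = u * b})

/-- If `u` normalizes the Ore extension generated by `S` and `x`, if `u` commutes with the
generators of `S` up to scalars, and if `u x = (g x + d) u` with `g` a scalar and `d ∈ S` a
`σ`-eigenvector with the same eigenvalue as `x`, then `d = 0`. -/
theorem eq_zero_of_mul_eq [NoZeroDivisors R] {X : Set R} {S : Subalgebra K R}
    (hSX : S = Algebra.adjoin K X) {σ : R →ₐ[K] R} (hinj : Function.Injective σ) {x : R} {l : K}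
    (hl : l ≠ 0) (hroot : ∀ n : ℕ, 1 ≤ n → l ^ n ≠ 1) (hx : σ x = l • x)
    (hσX : ∀ z ∈ X, ∃ c : K, c ≠ 0 ∧ σ z = c • z)
    (hσS : ∀ b ∈ S, σ b ∈ S) (hDS : ∀ b ∈ S, skewInner σ x b ∈ S)
    (hnil : ∀ b ∈ S, ∃ n : ℕ, (skewInner σ x)^[n] b = 0) {u d : R} {g : K} (hu : u ≠ 0)
    (hdS : d ∈ S) (hσd : σ d = l • d) (huX : ∀ z ∈ X, ∃ c : K, u * z = c • (z * u))
    (hud : ∃ b ∈ S, d * u = u * b) (hux : u * x = (g • x + d) * u) : d = 0 := by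
  by_contra hd
  have hex : ∀ b ∈ S, ∃ b' ∈ S, u * b = b' * u ∧ u * σ b = σ b' * u := by
    intro b hb
    rw [hSX] at hb
    induction hb using Algebra.adjoin_induction with
    | mem z hz =>
      obtain ⟨c, hc⟩ := huX z hz
      obtain ⟨t, -, ht⟩ := hσX z hz
      refine ⟨c • z, S.smul_mem (hSX ▸ Algebra.subset_adjoin hz) c, ?_, ?_⟩
      · rw [hc, smul_mul_assoc]
      · rw [map_smul, ht, mul_smul_comm, hc, smul_mul_assoc, smul_mul_assoc, smul_comm]
    | algebraMap c =>
      refine ⟨algebraMap K R c, S.algebraMap_mem c, ?_, ?_⟩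
      · exact (Algebra.commutes c u).symm
      · rw [AlgHom.commutes]
        exact (Algebra.commutes c u).symm
    | add y z _ _ hy hz =>
      obtain ⟨y', hyS, h1, h2⟩ := hy
      obtain ⟨z', hzS, h3, h4⟩ := hz
      refine ⟨y' + z', S.add_mem hyS hzS, ?_, ?_⟩
      · rw [mul_add, h1, h3, add_mul]
      · rw [map_add, mul_add, h2, h4, map_add, add_mul]
    | mul y z _ _ hy hz =>
      obtain ⟨y', hyS, h1, h2⟩ := hy
      obtain ⟨z', hzS, h3, h4⟩ := hz
      refine ⟨y' * z', S.mul_mem hyS hzS, ?_, ?_⟩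
      · rw [← mul_assoc, h1, mul_assoc, h3, mul_assoc]
      · rw [map_mul, ← mul_assoc, h2, mul_assoc, h4, map_mul, mul_assoc]
  have hσu : ∀ b ∈ S, ∀ b' : R, u * b = b' * u → u * σ b = σ b' * u := by
    intro b hb b' h
    obtain ⟨b'', -, h1, h2⟩ := hex b hb
    rw [h, mul_left_inj' hu] at h1
    rw [h1, h2]
  have hstep : ∀ b ∈ S, ∀ b' : R, u * b = b' * u →
      u * skewInner σ x b = skewInner σ (g • x + d) b' * u := by
    intro b hb b' h
    rw [skewInner_apply, skewInner_apply, mul_sub, sub_mul, ← mul_assoc, hux, mul_assoc, h,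
      ← mul_assoc, ← mul_assoc, hσu b hb b' h, mul_assoc (σ b'), hux, mul_assoc (σ b')]
  have hit : ∀ n : ℕ, ∀ b ∈ S, ∀ b' : R, u * b = b' * u →
      u * (skewInner σ x)^[n] b = (skewInner σ (g • x + d))^[n] b' * u := by
    intro n
    induction n with
    | zero => exact fun b _ b' h => h
    | succ n ih => exact fun b hb b' h => ih _ (hDS b hb) _ (hstep b hb b' h)
  obtain ⟨b, hbS, hb⟩ := hud
  obtain ⟨n, hn⟩ := hnil b hbS
  have h := hit n b hbS d hb.symm
  rw [hn, mul_zero, eq_comm, mul_eq_zero] at h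
  exact perturbed_iterate_ne_zero (fun a _ b _ hab => mul_eq_zero.1 hab) hinj hl hroot hx hσS hDS
    hdS hd hσd (hnil d hdS) g n (h.resolve_right hu)

theorem mul_eq_smul_of_normalIn [NoZeroDivisors R] {r : ℕ} (A : (Fin r → ℤ) → Submodule K R)
    [GradedAlgebra A] {X : Set R} {S T : Subalgebra K R}
    (hSX : S = Algebra.adjoin K X) {σ : R →ₐ[K] R} (hinj : Function.Injective σ) {x : R} {l : K}
    (hl : l ≠ 0) (hroot : ∀ n : ℕ, 1 ≤ n → l ^ n ≠ 1) (hx : σ x = l • x)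
    (hσX : ∀ z ∈ X, ∃ c : K, c ≠ 0 ∧ σ z = c • z)
    (hσS : ∀ b ∈ S, σ b ∈ S) (hDS : ∀ b ∈ S, skewInner σ x b ∈ S)
    (hnil : ∀ b ∈ S, ∃ n : ℕ, (skewInner σ x)^[n] b = 0)
    (hfree : ∀ n : ℕ, ∀ a ∈ S, a * x ^ n ∈ lowDeg S x n → a = 0)
    (hST : S ≤ T) (hxT : x ∈ T) (hT : ∀ z ∈ T, ∃ n, z ∈ lowDeg S x n)
    {ρ : Fin r → ℤ} (hxA : x ∈ A ρ) (hσA : ∀ a ∈ A ρ, σ a = l • a)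
    (hunits : ∀ a ∈ S, ∀ b ∈ S, a * b = 1 → ∃ c : K, a = algebraMap K R c)
    (hS : ∀ a ∈ S, a ≠ 0 → NormalIn (S : Set R) a → ∀ z ∈ X, ∃ c : K, a * z = c • (z * a))
    {u : R} (huT : u ∈ T) (hu : u ≠ 0) (hnorm : NormalIn (T : Set R) u) :
    (∀ z ∈ X, ∃ c : K, u * z = c • (z * u)) ∧ ∃ c : K, u * x = c • (x * u) := by
  have hdom : ∀ a ∈ S, ∀ b ∈ S, a * b = 0 → a = 0 ∨ b = 0 := fun a _ b _ h => mul_eq_zero.1 h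
  have hnt : Nontrivial R := ⟨u, 0, hu⟩
  have hlead : ∀ {z w a b : R} {n m : ℕ}, HasLead S x z n a → HasLead S x w m b →
      HasLead S x (z * w) (n + m) (a * σ^[n] b) := fun hz hw => hz.mul hσS hDS hinj hdom hw
  obtain ⟨n₀, hn₀⟩ := hT u huT
  obtain ⟨n, a, ha⟩ := exists_hasLead hn₀ hu
  -- conjugation by `u` preserves `S`
  have hleft : ∀ b ∈ S, ∃ b' ∈ S, u * b = b' * u ∧ a * σ^[n] b = b' * a := by
    intro b hb
    by_cases hb0 : b = 0
    · exact ⟨0, S.zero_mem, by simp [hb0], by simp [hb0, iterate_map_zero]⟩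
    obtain ⟨b', hb'T, h⟩ := hnorm.exists_left (hST hb)
    have hb'0 : b' ≠ 0 := by
      rintro rfl
      rw [zero_mul] at h
      exact mul_ne_zero hu hb0 h
    obtain ⟨m₀, hm₀⟩ := hT b' hb'T
    obtain ⟨m, e, he⟩ := exists_hasLead hm₀ hb'0
    have h1 := hlead ha (hasLead_of_mem hb hb0)
    rw [h] at h1
    obtain ⟨h2, h3⟩ := hasLead_unique hfree h1 (hlead he ha)
    obtain rfl : m = 0 := by omega
    obtain rfl := he.eq_of_zero
    exact ⟨b', he.1, h, h3⟩
  have hright : ∀ b ∈ S, ∃ b' ∈ S, b * u = u * b' ∧ a * σ^[n] b' = b * a := by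
    intro b hb
    by_cases hb0 : b = 0
    · exact ⟨0, S.zero_mem, by simp [hb0], by simp [hb0, iterate_map_zero]⟩
    obtain ⟨b', hb'T, h⟩ := hnorm.exists_right (hST hb)
    have hb'0 : b' ≠ 0 := by
      rintro rfl
      rw [mul_zero] at h
      exact mul_ne_zero hb0 hu h
    obtain ⟨m₀, hm₀⟩ := hT b' hb'T
    obtain ⟨m, e, he⟩ := exists_hasLead hm₀ hb'0
    have h1 := hlead (hasLead_of_mem hb hb0) ha
    rw [h] at h1
    obtain ⟨h2, h3⟩ := hasLead_unique hfree h1 (hlead ha he)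
    obtain rfl : m = 0 := by omega
    obtain rfl := he.eq_of_zero
    exact ⟨b', he.1, h, h3.symm⟩
  have hsurj1 : ∀ b ∈ S, ∃ b₀ ∈ S, σ b₀ = b := by
    intro b hb
    have : S ≤ S.map σ := by
      conv_lhs => rw [hSX]
      refine Algebra.adjoin_le fun z hz => ?_
      obtain ⟨c, hc, hz'⟩ := hσX z hz
      exact ⟨c⁻¹ • z, S.smul_mem (hSX ▸ Algebra.subset_adjoin hz) _, by
        change σ (c⁻¹ • z) = z
        rw [map_smul, hz', inv_smul_smul₀ hc]⟩
    exact this hb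
  have hsurj : ∀ m : ℕ, ∀ b ∈ S, ∃ b₀ ∈ S, σ^[m] b₀ = b := by
    intro m
    induction m with
    | zero => exact fun b hb => ⟨b, hb, rfl⟩
    | succ m ih =>
      intro b hb
      obtain ⟨b₁, hb₁, h1⟩ := ih b hb
      obtain ⟨b₀, hb₀, h0⟩ := hsurj1 b₁ hb₁
      exact ⟨b₀, hb₀, by rw [Function.iterate_succ_apply, h0, h1]⟩
  have hanorm : NormalIn (S : Set R) a := by
    ext y
    constructor
    · rintro ⟨b, hb, rfl⟩
      obtain ⟨b₀, hb₀, rfl⟩ := hsurj n b hb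
      obtain ⟨b', hb', -, h⟩ := hleft b₀ hb₀
      exact ⟨b', hb', h⟩
    · rintro ⟨b, hb, rfl⟩
      obtain ⟨b', hb', -, h⟩ := hright b hb
      exact ⟨_, iterate_mem hσS n b' hb', h.symm⟩
  have huX : ∀ z ∈ X, ∃ c : K, u * z = c • (z * u) := by
    intro z hz
    obtain ⟨c, hc⟩ := hS a ha.1 ha.2.1 hanorm z hz
    obtain ⟨t, -, ht⟩ := hσX z hz
    obtain ⟨b', -, h1, h2⟩ := hleft z (hSX ▸ Algebra.subset_adjoin hz)
    have hit : ∀ m : ℕ, σ^[m] z = t ^ m • z := by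
      intro m
      induction m with
      | zero => simp
      | succ m ih => rw [Function.iterate_succ_apply', ih, map_smul, ht, smul_smul, pow_succ]
    rw [hit, mul_smul_comm, hc, smul_smul, ← smul_mul_assoc, mul_left_inj' ha.2.1] at h2
    exact ⟨t ^ n * c, by rw [h1, ← h2, smul_mul_assoc]⟩
  refine ⟨huX, ?_⟩
  have hone : (1 : R) ≠ 0 := one_ne_zero
  have hxlead : HasLead S x x 1 1 := ⟨S.one_mem, hone, by simp⟩
  have hx0 : x ≠ 0 := by
    rintro rfl
    refine hone (hfree 1 1 S.one_mem ?_)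
    simp
  obtain ⟨y, hyT, hy⟩ := hnorm.exists_left hxT
  have hy0 : y ≠ 0 := by
    rintro rfl
    rw [zero_mul] at hy
    exact mul_ne_zero hu hx0 hy
  obtain ⟨z, hzT, hz⟩ := hnorm.exists_right hxT
  have hz0 : z ≠ 0 := by
    rintro rfl
    rw [mul_zero] at hz
    exact mul_ne_zero hx0 hu hz
  obtain ⟨m₀, hm₀⟩ := hT y hyT
  obtain ⟨m, c, hc⟩ := exists_hasLead hm₀ hy0
  obtain ⟨m₀', hm₀'⟩ := hT z hzT
  obtain ⟨m', c', hc'⟩ := exists_hasLead hm₀' hz0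
  have h1 := hlead ha hxlead
  rw [hy] at h1
  obtain ⟨h2, h3⟩ := hasLead_unique hfree h1 (hlead hc ha)
  obtain rfl : m = 1 := by omega
  have h4 := hlead hxlead ha
  rw [hz] at h4
  obtain ⟨h5, h6⟩ := hasLead_unique hfree h4 (hlead ha hc')
  have hσ1 : σ^[n] 1 = 1 := iterate_map_one σ n
  rw [hσ1, mul_one, Function.iterate_one] at h3
  rw [Function.iterate_one, one_mul] at h6
  obtain ⟨s, hs, h7⟩ := hanorm.exists_left (iterate_mem hσS n c' hc'.1)
  rw [h6, h7, ← mul_assoc] at h3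
  have hcs : c * s = 1 := by
    rw [← mul_left_inj' ha.2.1, ← h3, one_mul]
  obtain ⟨g, rfl⟩ := hunits c hc.1 s hs hcs
  set d := y - algebraMap K R g * x ^ 1 with hd
  have hdS : d ∈ S := mem_of_mem_lowDeg_one hc.2.2
  have hyd : y = g • x + d := by rw [hd, pow_one, Algebra.smul_def]; abel
  have hyA : y ∈ A ρ := mem_of_mul_eq A hu hxA hy
  have hdA : d ∈ A ρ := by
    rw [hd, pow_one, ← Algebra.smul_def]
    exact sub_mem hyA (Submodule.smul_mem _ g hxA)
  rw [hyd] at hy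
  obtain ⟨b, hb, hdb, -⟩ := hright d hdS
  have hd0 := eq_zero_of_mul_eq hSX hinj hl hroot hx hσX hσS hDS hnil hu hdS (hσA d hdA) huX
    ⟨b, hb, hdb⟩ hy
  exact ⟨g, by rw [hy, hd0, add_zero, smul_mul_assoc]⟩

end NormalElements

section PBW

variable {K : Type*} [Field K] {R : Type*} [Ring R] [Algebra K R] {N r : ℕ}

theorem prod_map_pow_add_single (x : Fin N → R) (f : Fin N → ℕ) (k : Fin N) (n : ℕ)
    (hf : ∀ j, k ≤ j → f j = 0) :
    ∀ l : List (Fin N), l.Pairwise (· < ·) → k ∈ l →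
      (l.map fun i => x i ^ (f + Pi.single k n : Fin N → ℕ) i).prod =
        (l.map fun i => x i ^ f i).prod * x k ^ n
  | [], _, hk => absurd hk List.not_mem_nil
  | i :: l, hl, hk => by
    rw [List.pairwise_cons] at hl
    rw [List.map_cons, List.map_cons, List.prod_cons, List.prod_cons]
    rcases List.mem_cons.1 hk with rfl | hk
    · have h1 : ∀ g : Fin N → ℕ, (∀ j, k < j → g j = 0) →
          (l.map fun i => x i ^ g i).prod = 1 := by
        intro g hg
        refine List.prod_eq_one fun y hy => ?_
        obtain ⟨j, hj, rfl⟩ := List.mem_map.1 hy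
        rw [hg j (hl.1 j hj), pow_zero]
      rw [h1 f fun j hj => hf j hj.le, h1 _ fun j hj => by
        rw [Pi.add_apply, hf j hj.le, Pi.single_eq_of_ne hj.ne', add_zero]]
      simp [hf k le_rfl]
    · rw [prod_map_pow_add_single x f k n hf l hl.2 hk, Pi.add_apply,
        Pi.single_eq_of_ne (hl.1 k hk).ne, add_zero, mul_assoc]

theorem xmon_add_single (x : Fin N → R) (f : Fin N → ℕ) (k : Fin N) (n : ℕ)
    (hf : ∀ j, k ≤ j → f j = 0) : xmon x (f + Pi.single k n) = xmon x f * x k ^ n :=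
  prod_map_pow_add_single x f k n hf _ (List.pairwise_lt_finRange N) (List.mem_finRange k)

theorem xmon_zero (x : Fin N → R) : xmon x 0 = 1 := by
  refine List.prod_eq_one fun y hy => ?_
  obtain ⟨j, -, rfl⟩ := List.mem_map.1 hy
  exact pow_zero _

/-- The span of the ordered monomials in the first `k` variables. -/
def monSpan (K : Type*) [Field K] {R : Type*} [Ring R] [Algebra K R] {N : ℕ}
    (x : Fin N → R) (k : ℕ) : Submodule K R :=
  Submodule.span K {y | ∃ f : Fin N → ℕ, (∀ j : Fin N, k ≤ j → f j = 0) ∧ y = xmon x f}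

theorem mul_pow_mem_monSpan (x : Fin N → R) (k : Fin N) {a : R} (ha : a ∈ monSpan K x k)
    (n : ℕ) : a * x k ^ n ∈ monSpan K x (k + 1) := by
  induction ha using Submodule.span_induction with
  | mem y hy =>
    obtain ⟨f, hf, rfl⟩ := hy
    refine Submodule.subset_span ⟨f + Pi.single k n, fun j hj => ?_, ?_⟩
    · have hkj : k < j := hj
      rw [Pi.add_apply, hf j hkj.le, Pi.single_eq_of_ne hkj.ne', add_zero]
    · rw [xmon_add_single x f k n fun j hj => hf j hj]
  | zero => simp
  | add y z _ _ hy hz => rw [add_mul]; exact add_mem hy hz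
  | smul c y _ hy => rw [smul_mul_assoc]; exact Submodule.smul_mem _ c hy

variable {E : CGLData K R N r}

/-- The PBW basis. -/
noncomputable def CGLData.IsCGL.basis (hE : E.IsCGL) : Module.Basis (Fin N → ℕ) K R :=
  Module.Basis.ofRepr (LinearEquiv.ofBijective (Finsupp.linearCombination K (xmon E.x))
    ((Function.bijective_iff_existsUnique _).2 fun a => by
      obtain ⟨c, hc, hu⟩ := hE.pbw a
      exact ⟨c, hc.symm, fun d hd => hu d hd.symm⟩)).symm

theorem CGLData.IsCGL.basis_apply (hE : E.IsCGL) (f : Fin N → ℕ) : hE.basis f = xmon E.x f := by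
  simp [basis, LinearEquiv.ofBijective_apply]

theorem CGLData.IsCGL.nontrivial (hE : E.IsCGL) : Nontrivial R :=
  ⟨hE.basis 0, 0, hE.basis.ne_zero 0⟩

theorem CGLData.IsCGL.actHom_x (hE : E.IsCGL) (t : Fin r → Kˣ) (j : Fin N) :
    E.actHom t (E.x j) = ((tpow t (E.ρ j) : Kˣ) : K) • E.x j :=
  E.act_of_mem t (hE.xhom j)

theorem CGLData.IsCGL.skewInner_mem (hE : E.IsCGL) (k : Fin N) :
    ∀ b ∈ E.sub k, skewInner (E.actHom (E.h k)) (E.x k) b ∈ E.sub k :=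
  hE.delta_stab k

theorem CGLData.IsCGL.exists_mem_lowDeg (hE : E.IsCGL) (k : Fin N) :
    ∀ z ∈ E.sub (k + 1), ∃ n, z ∈ lowDeg (E.sub k) (E.x k) n := fun z hz => by
  refine _root_.exists_mem_lowDeg (σ := E.actHom (E.h k)) (hE.sigma_stab k) (hE.skewInner_mem k)
    ?_ hz
  rintro _ ⟨j, hj, rfl⟩
  rcases Nat.lt_succ_iff_lt_or_eq.1 hj with h | h
  · exact Or.inl (Algebra.subset_adjoin ⟨j, h, rfl⟩)
  · exact Or.inr (by rw [Fin.ext h])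

theorem CGLData.mem_sub_zero {a : R} (ha : a ∈ E.sub 0) : ∃ c : K, a = algebraMap K R c := by
  have h0 : {y : R | ∃ j : Fin N, (j : ℕ) < 0 ∧ y = E.x j} = ∅ := by
    ext y; simp
  rw [CGLData.sub, h0, Algebra.adjoin_empty, Algebra.mem_bot] at ha
  obtain ⟨c, rfl⟩ := ha
  exact ⟨c, rfl⟩

theorem CGLData.IsCGL.sub_le_monSpan (hE : E.IsCGL) (k : ℕ) (hk : k ≤ N) :
    ∀ a ∈ E.sub k, a ∈ monSpan K E.x k := by
  induction k with
  | zero =>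
    intro a ha
    obtain ⟨c, rfl⟩ := E.mem_sub_zero ha
    rw [Algebra.algebraMap_eq_smul_one, ← xmon_zero E.x]
    exact Submodule.smul_mem _ c (Submodule.subset_span ⟨0, fun _ _ => rfl, rfl⟩)
  | succ k ih =>
    intro a ha
    obtain ⟨n, hn⟩ := hE.exists_mem_lowDeg ⟨k, hk⟩ a ha
    refine Submodule.span_le.2 ?_ hn
    rintro _ ⟨i, -, b, hb, rfl⟩
    exact mul_pow_mem_monSpan E.x ⟨k, hk⟩ (ih (Nat.le_of_succ_le hk) b hb) i

theorem CGLData.IsCGL.repr_mul_pow (hE : E.IsCGL) (k : Fin N) {a : R}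
    (ha : a ∈ monSpan K E.x k) (n : ℕ) (f : Fin N → ℕ) :
    hE.basis.repr (a * E.x k ^ n) (f + Pi.single k n) = hE.basis.repr a f := by
  classical
  induction ha using Submodule.span_induction with
  | mem y hy =>
    obtain ⟨g, hg, rfl⟩ := hy
    rw [← xmon_add_single E.x g k n fun j hj => hg j hj, ← hE.basis_apply, ← hE.basis_apply,
      Module.Basis.repr_self, Module.Basis.repr_self, Finsupp.single_apply, Finsupp.single_apply]
    simp
  | zero => simp
  | add y z _ _ hy hz => simp [add_mul, hy, hz]
  | smul c y _ hy => simp [hy]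

theorem CGLData.IsCGL.repr_lowDeg (hE : E.IsCGL) (k : Fin N) {a : R} {n : ℕ}
    (ha : a ∈ lowDeg (E.sub k) (E.x k) n) (f : Fin N → ℕ) :
    hE.basis.repr a (f + Pi.single k n) = 0 := by
  classical
  induction ha using Submodule.span_induction with
  | mem y hy =>
    obtain ⟨i, hi, b, hb, rfl⟩ := hy
    have hb' := hE.sub_le_monSpan k k.2.le b hb
    clear hb
    induction hb' using Submodule.span_induction with
    | mem y hy =>
      obtain ⟨g, hg, rfl⟩ := hy
      rw [← xmon_add_single E.x g k i fun j hj => hg j hj, ← hE.basis_apply,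
        Module.Basis.repr_self, Finsupp.single_apply, if_neg]
      intro h
      have h1 := congrFun h k
      simp only [Pi.add_apply, Pi.single_eq_same, hg k le_rfl] at h1
      omega
    | zero => simp
    | add y z _ _ hy hz => simp [add_mul, hy, hz]
    | smul c y _ hy => simp [hy]
  | zero => simp
  | add y z _ _ hy hz => simp [hy, hz]
  | smul c y _ hy => simp [hy]

theorem CGLData.IsCGL.eq_zero_of_mul_pow_mem (hE : E.IsCGL) (k : Fin N) (n : ℕ) :
    ∀ a ∈ E.sub k, a * E.x k ^ n ∈ lowDeg (E.sub k) (E.x k) n → a = 0 := by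
  intro a ha h
  refine (LinearEquiv.map_eq_zero_iff hE.basis.repr).1 (Finsupp.ext fun f => ?_)
  rw [← hE.repr_mul_pow k (hE.sub_le_monSpan k k.2.le a ha) n f, hE.repr_lowDeg k h f,
    Finsupp.zero_apply]

theorem CGLData.IsCGL.sub_eq_top (hE : E.IsCGL) : E.sub N = ⊤ := by
  refine Algebra.eq_top_iff.2 fun a => ?_
  obtain ⟨c, rfl, -⟩ := hE.pbw a
  refine Subalgebra.sum_mem _ fun f _ => Subalgebra.smul_mem _ (list_prod_mem ?_) _
  intro y hy
  obtain ⟨j, -, rfl⟩ := List.mem_map.1 hy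
  have hj : E.x j ∈ E.sub N := Algebra.subset_adjoin ⟨j, j.2, rfl⟩
  exact pow_mem hj _

theorem CGLData.IsCGL.mul_eq_zero_of_mem_sub (hE : E.IsCGL) (k : ℕ) (hk : k ≤ N) :
    ∀ a ∈ E.sub k, ∀ b ∈ E.sub k, a * b = 0 → a = 0 ∨ b = 0 := by
  induction k with
  | zero =>
    intro a ha b hb h
    have := hE.nontrivial
    obtain ⟨c, rfl⟩ := E.mem_sub_zero ha
    obtain ⟨d, rfl⟩ := E.mem_sub_zero hb
    rw [← map_mul, FaithfulSMul.algebraMap_eq_zero_iff, mul_eq_zero] at h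
    exact h.imp (by rintro rfl; simp) (by rintro rfl; simp)
  | succ k ih =>
    intro a ha b hb h
    by_contra! hab
    obtain ⟨n₀, hn₀⟩ := hE.exists_mem_lowDeg ⟨k, hk⟩ a ha
    obtain ⟨m₀, hm₀⟩ := hE.exists_mem_lowDeg ⟨k, hk⟩ b hb
    obtain ⟨n, c, hc⟩ := exists_hasLead hn₀ hab.1
    obtain ⟨m, d, hd⟩ := exists_hasLead hm₀ hab.2
    have hl := hc.mul (hE.sigma_stab ⟨k, hk⟩) (hE.skewInner_mem ⟨k, hk⟩) (E.actHom_injective _)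
      (ih (Nat.le_of_succ_le hk)) hd
    rw [h] at hl
    refine hl.2.1 (hE.eq_zero_of_mul_pow_mem ⟨k, hk⟩ (n + m) _ hl.1 ?_)
    simpa using hl.2.2

theorem CGLData.IsCGL.noZeroDivisors (hE : E.IsCGL) : NoZeroDivisors R :=
  ⟨fun {a b} h => hE.mul_eq_zero_of_mem_sub N le_rfl a (hE.sub_eq_top ▸ Algebra.mem_top) b
    (hE.sub_eq_top ▸ Algebra.mem_top) h⟩

theorem CGLData.IsCGL.eq_algebraMap_of_mul_eq_one (hE : E.IsCGL) (k : ℕ) (hk : k ≤ N) :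
    ∀ a ∈ E.sub k, ∀ b ∈ E.sub k, a * b = 1 → ∃ c : K, a = algebraMap K R c := by
  induction k with
  | zero => exact fun a ha _ _ _ => E.mem_sub_zero ha
  | succ k ih =>
    intro a ha b hb h
    have := hE.nontrivial
    have hone : (1 : R) ≠ 0 := one_ne_zero
    obtain ⟨n₀, hn₀⟩ := hE.exists_mem_lowDeg ⟨k, hk⟩ a ha
    obtain ⟨m₀, hm₀⟩ := hE.exists_mem_lowDeg ⟨k, hk⟩ b hb
    obtain ⟨n, c, hc⟩ := exists_hasLead hn₀ (left_ne_zero_of_mul (h.trans_ne hone))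
    obtain ⟨m, d, hd⟩ := exists_hasLead hm₀ (right_ne_zero_of_mul (h.trans_ne hone))
    have hl := hc.mul (hE.sigma_stab ⟨k, hk⟩) (hE.skewInner_mem ⟨k, hk⟩) (E.actHom_injective _)
      (hE.mul_eq_zero_of_mem_sub k (Nat.le_of_succ_le hk)) hd
    rw [h] at hl
    obtain ⟨hnm, -⟩ := hasLead_unique (hE.eq_zero_of_mul_pow_mem ⟨k, hk⟩) hl
      (hasLead_of_mem (E.sub k).one_mem hone)
    obtain ⟨rfl, rfl⟩ : n = 0 ∧ m = 0 := by omega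
    obtain rfl := hc.eq_of_zero
    obtain rfl := hd.eq_of_zero
    exact ih (Nat.le_of_succ_le hk) a hc.1 b hd.1 h

theorem CGLData.IsCGL.mul_x_eq_smul (hE : E.IsCGL) (k : ℕ) (hk : k ≤ N) :
    ∀ u ∈ E.sub k, u ≠ 0 → NormalIn (E.sub k : Set R) u →
      ∀ z ∈ {y : R | ∃ j : Fin N, (j : ℕ) < k ∧ y = E.x j}, ∃ c : K, u * z = c • (z * u) := by
  induction k with
  | zero =>
    rintro u - - - _ ⟨j, hj, -⟩
    exact absurd hj (Nat.not_lt_zero _)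
  | succ k ih =>
    intro u hu hu0 hn
    let := E.graded
    have := hE.noZeroDivisors
    have hk' := Nat.le_of_succ_le hk
    obtain ⟨h1, h2⟩ := mul_eq_smul_of_normalIn E.A (S := E.sub k) (T := E.sub (k + 1)) rfl
      (E.actHom_injective (E.h ⟨k, hk⟩)) (Units.ne_zero _)
      (fun n hn h => hE.notroot ⟨k, hk⟩ n hn (Units.ext (by simpa using h)))
      (hE.actHom_x (E.h ⟨k, hk⟩) ⟨k, hk⟩)
      (by rintro _ ⟨j, -, rfl⟩; exact ⟨_, Units.ne_zero _, hE.actHom_x _ j⟩)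
      (hE.sigma_stab ⟨k, hk⟩) (hE.skewInner_mem ⟨k, hk⟩) (hE.delta_nil ⟨k, hk⟩)
      (hE.eq_zero_of_mul_pow_mem ⟨k, hk⟩)
      (Algebra.adjoin_mono fun y ⟨j, hj, e⟩ => ⟨j, hj.trans (Nat.lt_succ_self k), e⟩)
      (Algebra.subset_adjoin ⟨⟨k, hk⟩, Nat.lt_succ_self k, rfl⟩) (hE.exists_mem_lowDeg ⟨k, hk⟩)
      (hE.xhom ⟨k, hk⟩) (fun a ha => E.act_of_mem _ ha)
      (hE.eq_algebraMap_of_mul_eq_one k hk') (ih hk') hu hu0 hn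
    rintro _ ⟨j, hj, rfl⟩
    rcases Nat.lt_succ_iff_lt_or_eq.1 hj with h | h
    · exact h1 _ ⟨j, h, rfl⟩
    · rw [show j = ⟨k, hk⟩ from Fin.ext h]
      exact h2

/-- In a domain, a nonzero normal element acts by conjugation as an algebra automorphism. -/
theorem IsNormalElem.exists_algEquiv [NoZeroDivisors R] {u : R} (hu : u ≠ 0)
    (h : IsNormalElem u) : ∃ ψ : R ≃ₐ[K] R, ∀ a : R, u * a = ψ a * u := by
  have h1 : ∀ a, ∃ b, u * a = b * u := fun a =>
    (h.subset ⟨a, rfl⟩ : u * a ∈ {y : R | ∃ t : R, y = t * u})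
  have h2 : ∀ a, ∃ b, a * u = u * b := fun a =>
    (h.superset ⟨a, rfl⟩ : a * u ∈ {y : R | ∃ t : R, y = u * t})
  choose f hf using h1
  have hfu : ∀ a b, u * a = b * u → f a = b := fun a b hab => by
    rwa [hf, mul_left_inj' hu] at hab
  let φ : R →ₐ[K] R :=
    { toFun := f
      map_one' := hfu _ _ (by rw [mul_one, one_mul])
      map_mul' := fun a b => hfu _ _ (by rw [← mul_assoc, hf, mul_assoc, hf, mul_assoc])
      map_zero' := hfu _ _ (by rw [mul_zero, zero_mul])
      map_add' := fun a b => hfu _ _ (by rw [mul_add, hf, hf, add_mul])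
      commutes' := fun c => hfu _ _ (Algebra.commutes c u).symm }
  refine ⟨AlgEquiv.ofBijective φ ⟨fun a b hab => ?_, fun b => ?_⟩, hf⟩
  · have hab' : f a = f b := hab
    rw [← mul_right_inj' hu, hf, hf, hab']
  · obtain ⟨a, ha⟩ := h2 b
    exact ⟨a, hfu a b ha.symm⟩

end PBW

/-- **Corollary 5.6** of Goodearl–Yakimov: for every nonzero normal element
`u` of a CGL extension `R`, there is a `K`-algebra automorphism `ψ` of `R`
for which each generator `x_i` is an eigenvector and such that
`u·a = ψ(a)·u` for all `a ∈ R`. -/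
theorem stmt19 {K : Type*} [Field K] {R : Type*} [Ring R] [Algebra K R]
    {N r : ℕ} (E : CGLData K R N r) (hE : E.IsCGL) :
    ∀ u : R, u ≠ 0 → IsNormalElem u →
      ∃ ψ : R ≃ₐ[K] R,
        (∀ i : Fin N, ∃ t : Kˣ, ψ (E.x i) = (t : K) • E.x i) ∧
        ∀ a : R, u * a = ψ a * u := by
  intro u hu hn
  have := hE.noZeroDivisors
  obtain ⟨ψ, hψ⟩ := hn.exists_algEquiv (K := K) hu
  refine ⟨ψ, fun i => ?_, hψ⟩
  have hN : NormalIn (E.sub N : Set R) u := by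
    rw [hE.sub_eq_top]
    simpa [NormalIn, IsNormalElem] using hn
  obtain ⟨c, hc⟩ := hE.mul_x_eq_smul N le_rfl u (hE.sub_eq_top ▸ Algebra.mem_top) hu hN (E.x i)
    ⟨i, i.2, rfl⟩
  have hc0 : c ≠ 0 := by
    rintro rfl
    rw [zero_smul] at hc
    exact mul_ne_zero hu (hE.xne i) hc
  refine ⟨Units.mk0 c hc0, ?_⟩
  rw [hψ, ← smul_mul_assoc, mul_left_inj' hu] at hc
  exact hc
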